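/- arXiv:1212.4417 — 2 statements merged into one kernel-verified Lean document; each statement's English description precedes it below -/
import Mathlib

section
/- Let H₁ and H₂ be complex Hilbert spaces, T a closed, densely defined linear operator from H₁ to H₂, and F a closed subspace of H₂ containing the range of T. If there is a constant c > 0 such that c·‖y‖² ≤ ‖T*y‖² for all y in Dom(T*) ∩ F, then for every y ∈ F there exists x ∈ Dom(T) with T x = y and ‖x‖² ≤ (1/c)·‖y‖². -/
open InnerProductSpace

/-- A linear functional dominated by `C * ‖L v‖` is represented through `L` by a vector of norm
at most `C`. -/
theorem exists_inner_eq_of_norm_le {𝕜 V H : Type*} [RCLike 𝕜] [AddCommGroup V] [Module 𝕜 V]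
    [NormedAddCommGroup H] [InnerProductSpace 𝕜 H] [CompleteSpace H]
    (L : V →ₗ[𝕜] H) (φ : V →ₗ[𝕜] 𝕜) {C : ℝ} (hC : 0 ≤ C) (h : ∀ v, ‖φ v‖ ≤ C * ‖L v‖) :
    ∃ x : H, ‖x‖ ≤ C ∧ ∀ v, inner 𝕜 x (L v) = φ v := by
  obtain ⟨g, hg⟩ := L.rangeRestrict.exists_rightInverse_of_surjective L.range_rangeRestrict
  have hLg (w : L.range) : L (g w) = w := congrArg Subtype.val (LinearMap.congr_fun hg w)
  let ψ : StrongDual 𝕜 L.range := (φ ∘ₗ g).mkContinuous C fun w => by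
    simpa [hLg] using h (g w)
  obtain ⟨f, hf, hfn⟩ := exists_extension_norm_eq L.range ψ
  refine ⟨(toDual 𝕜 H).symm f, ?_, fun v => ?_⟩
  · rw [LinearIsometryEquiv.norm_map, hfn]
    exact LinearMap.mkContinuous_norm_le _ hC _
  · have hker : φ (g (L.rangeRestrict v) - v) = 0 := by
      simpa [hLg] using h (g (L.rangeRestrict v) - v)
    rw [toDual_symm_apply, ← sub_eq_zero, ← hker, map_sub]
    exact congrArg (· - φ v) (hf (L.rangeRestrict v))

/-- A point outside a closed subspace is detected by a continuous functional vanishing on it. -/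
theorem Submodule.exists_strongDual_ne_zero_of_notMem {𝕜 E : Type*} [RCLike 𝕜]
    [NormedAddCommGroup E] [NormedSpace 𝕜 E] {S : Submodule 𝕜 E} (hS : IsClosed (S : Set E))
    {z : E} (hz : z ∉ S) : ∃ f : StrongDual 𝕜 E, (∀ s ∈ S, f s = 0) ∧ f z ≠ 0 := by
  have : IsClosed (S : Set E) := hS
  obtain ⟨f, hf⟩ := SeparatingDual.exists_ne_zero (R := 𝕜) (x := S.mkQ z) (by simpa using hz)
  refine ⟨f.comp S.mkQL, fun s hs => ?_, hf⟩
  have : S.mkQ s = 0 := by simpa using hs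
  exact (congrArg f this).trans (map_zero f)

namespace LinearPMap

variable {𝕜 E F : Type*} [RCLike 𝕜] [NormedAddCommGroup E] [InnerProductSpace 𝕜 E]
  [CompleteSpace E] [NormedAddCommGroup F] [InnerProductSpace 𝕜 F]

/-- The graph of a closed densely defined operator contains every pair which is formally adjoint
to the adjoint operator. -/
theorem IsClosed.mem_graph_of_inner_adjoint_eq [CompleteSpace F] {T : E →ₗ.[𝕜] F}
    (hT : T.IsClosed) (hd : Dense (T.domain : Set E)) {x : E} {y : F}
    (h : ∀ v : T.adjoint.domain, inner 𝕜 x (T.adjoint v) = inner 𝕜 y (v : F)) :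
    (x, y) ∈ T.graph := by
  by_contra hxy
  obtain ⟨f, hf, hne⟩ := Submodule.exists_strongDual_ne_zero_of_notMem hT hxy
  let u := (toDual 𝕜 E).symm (f.comp (.inl 𝕜 E F))
  let v := (toDual 𝕜 F).symm (f.comp (.inr 𝕜 E F))
  have hfuv (a : E) (b : F) : f (a, b) = inner 𝕜 u a + inner 𝕜 v b := by
    rw [toDual_symm_apply, toDual_symm_apply, ← f.comp_inl_add_comp_inr]
  have huv (a : T.domain) : inner 𝕜 (-u) (a : E) = inner 𝕜 v (T a) := by
    rw [inner_neg_left, neg_eq_iff_add_eq_zero, ← hfuv]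
    exact hf _ (T.mem_graph a)
  have hv : v ∈ T.adjoint.domain := mem_adjoint_domain_of_exists v ⟨-u, huv⟩
  have hadj : T.adjoint ⟨v, hv⟩ = -u := adjoint_apply_eq hd ⟨v, hv⟩ huv
  have key := h ⟨v, hv⟩
  rw [hadj, ← inner_conj_symm, ← inner_conj_symm y] at key
  apply hne
  rw [hfuv, ← (starRingEnd 𝕜).injective key, inner_neg_left, add_neg_cancel]

/-- Projecting onto a subspace containing the range of `T` preserves the domain of the adjoint of
`T` and the values of the adjoint. -/
theorem exists_adjoint_starProjection_eq {T : E →ₗ.[𝕜] F} (hd : Dense (T.domain : Set E))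
    (K : Submodule 𝕜 F) [K.HasOrthogonalProjection] (hK : ∀ x : T.domain, T x ∈ K)
    (v : T.adjoint.domain) :
    ∃ w : T.adjoint.domain, (w : F) = K.starProjection v ∧ T.adjoint w = T.adjoint v := by
  have h (x : T.domain) : inner 𝕜 (T.adjoint v) (x : E) = inner 𝕜 (K.starProjection v) (T x) := by
    rw [adjoint_isFormalAdjoint hd v x, ← sub_eq_zero, ← inner_sub_left]
    exact K.starProjection_inner_eq_zero v _ (hK x)
  have hw := mem_adjoint_domain_of_exists _ ⟨_, h⟩
  exact ⟨⟨_, hw⟩, rfl, adjoint_apply_eq hd ⟨_, hw⟩ h⟩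

end LinearPMap

/-- **Hörmander's functional-analytic lemma (sufficiency direction).**
Let `H₁`, `H₂` be complex Hilbert spaces, `T` a closed, densely defined linear
operator from `H₁` to `H₂`, and `F` a closed subspace of `H₂` containing the
range of `T`.  If there is a constant `c > 0` such that
`c‖y‖² ≤ ‖T*y‖²` for all `y ∈ Dom(T*) ∩ F`, then for every `y ∈ F` there is
`x ∈ Dom(T)` with `T x = y` and `‖x‖² ≤ (1/c)‖y‖²`. -/
theorem stmt0
    {H₁ H₂ : Type*}
    [NormedAddCommGroup H₁] [InnerProductSpace ℂ H₁] [CompleteSpace H₁]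
    [NormedAddCommGroup H₂] [InnerProductSpace ℂ H₂] [CompleteSpace H₂]
    (T : H₁ →ₗ.[ℂ] H₂)
    (hTclosed : T.IsClosed)
    (hTdense : Dense (T.domain : Set H₁))
    (F : Submodule ℂ H₂) (hF : IsClosed (F : Set H₂))
    (hrange : ∀ x : T.domain, T x ∈ F)
    (c : ℝ) (hc : 0 < c)
    (hineq : ∀ y : T.adjoint.domain, (y : H₂) ∈ F →
      c * ‖(y : H₂)‖ ^ 2 ≤ ‖T.adjoint y‖ ^ 2) :
    ∀ y ∈ F, ∃ x : T.domain, T x = y ∧ ‖(x : H₁)‖ ^ 2 ≤ (1 / c) * ‖y‖ ^ 2 := by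
  intro y hy
  have : CompleteSpace F := hF.completeSpace_coe
  have hbound (v : T.adjoint.domain) :
      ‖inner ℂ y (v : H₂)‖ ≤ ‖y‖ / √c * ‖T.adjoint v‖ := by
    obtain ⟨w, hw, hTw⟩ := LinearPMap.exists_adjoint_starProjection_eq hTdense F hrange v
    have hinner : inner ℂ y (v : H₂) = inner ℂ y (w : H₂) := by
      rw [hw, ← F.inner_starProjection_left_eq_right,
        Submodule.starProjection_eq_self_iff.mpr hy]
    have hsq : √c * ‖(w : H₂)‖ ≤ ‖T.adjoint w‖ := by
      refine le_of_sq_le_sq ?_ (norm_nonneg _)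
      rw [mul_pow, Real.sq_sqrt hc.le]
      exact hineq w (hw ▸ F.starProjection_apply_mem _)
    rw [hinner, ← hTw, div_mul_eq_mul_div, le_div_iff₀ (Real.sqrt_pos.mpr hc)]
    calc ‖inner ℂ y (w : H₂)‖ * √c ≤ ‖y‖ * ‖(w : H₂)‖ * √c := by
          gcongr; exact norm_inner_le_norm _ _
      _ = ‖y‖ * (√c * ‖(w : H₂)‖) := by ring
      _ ≤ ‖y‖ * ‖T.adjoint w‖ := by gcongr
  obtain ⟨x, hx, hxT⟩ := exists_inner_eq_of_norm_le T.adjoint.toFun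
    ((innerₛₗ ℂ y).comp T.adjoint.domain.subtype) (by positivity) hbound
  obtain ⟨z, hzx, hzy⟩ :=
    (LinearPMap.mem_graph_iff T).mp (hTclosed.mem_graph_of_inner_adjoint_eq hTdense hxT)
  refine ⟨z, hzy, ?_⟩
  calc ‖(z : H₁)‖ ^ 2 ≤ (‖y‖ / √c) ^ 2 := by rw [hzx]; gcongr
    _ = 1 / c * ‖y‖ ^ 2 := by rw [div_pow, Real.sq_sqrt hc.le]; ring
end

section
/- Let H₁ and H₂ be complex Hilbert spaces, T a closed, densely defined linear operator from H₁ to H₂, and F a closed subspace of H₂ containing the range of T. If T is surjective onto F, i.e. every y ∈ F equals T x for some x ∈ Dom(T), then there exists a constant c > 0 such that c·‖y‖² ≤ ‖T*y‖² for all y in Dom(T*) ∩ F. -/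
open InnerProductSpace

/-- If the range of a densely defined operator `T` contains a closed subspace `F`, then `T†` is
bounded below on `T†.domain ∩ F`. -/
theorem LinearPMap.exists_norm_le_mul_norm_adjoint {𝕜 E G : Type*} [RCLike 𝕜]
    [NormedAddCommGroup E] [InnerProductSpace 𝕜 E] [CompleteSpace E]
    [NormedAddCommGroup G] [InnerProductSpace 𝕜 G] [CompleteSpace G]
    {T : E →ₗ.[𝕜] G} (hT : Dense (T.domain : Set E))
    {F : Submodule 𝕜 G} (hF : _root_.IsClosed (F : Set G))
    (hsurj : ∀ y ∈ F, ∃ x : T.domain, T x = y) :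
    ∃ C : ℝ, 0 < C ∧ ∀ y : T.adjoint.domain, (y : G) ∈ F → ‖(y : G)‖ ≤ C * ‖T.adjoint y‖ := by
  have : CompleteSpace F := hF.completeSpace_coe
  have hadj := LinearPMap.adjoint_isFormalAdjoint hT
  let g : T.adjoint.domain → F →L[𝕜] 𝕜 := fun y ↦
    ((‖T.adjoint y‖⁻¹ : ℝ) : 𝕜) • (innerSL 𝕜 (y : G)).comp F.subtypeL
  have hg : ∀ y (z : F), ‖g y z‖ = ‖T.adjoint y‖⁻¹ * ‖inner 𝕜 (y : G) (z : G)‖ := by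
    intro y z
    simp [g]
  obtain ⟨C, hC⟩ : ∃ C, ∀ y, ‖g y‖ ≤ C := by
    refine banach_steinhaus fun z ↦ ?_
    obtain ⟨x, hx⟩ := hsurj z z.2
    refine ⟨‖(x : E)‖, fun y ↦ ?_⟩
    rw [hg, ← hx, ← hadj y x]
    calc ‖T.adjoint y‖⁻¹ * ‖inner 𝕜 (T.adjoint y) (x : E)‖
        ≤ ‖T.adjoint y‖⁻¹ * (‖T.adjoint y‖ * ‖(x : E)‖) := by
          gcongr
          exact norm_inner_le_norm _ _
      _ ≤ ‖(x : E)‖ := by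
          rw [← mul_assoc]
          exact mul_le_of_le_one_left (norm_nonneg _) inv_mul_le_one
  refine ⟨max C 1, by positivity, fun y hy ↦ ?_⟩
  rcases eq_or_ne (T.adjoint y) 0 with h0 | h0
  · obtain ⟨x, hx⟩ := hsurj y hy
    have h : inner 𝕜 (y : G) (y : G) = 0 := by
      have := hadj y x
      rwa [h0, inner_zero_left, hx, eq_comm] at this
    simp [h0, inner_self_eq_zero.1 h]
  · rcases eq_or_ne (y : G) 0 with hy0 | hy0
    · rw [hy0, norm_zero]
      positivity
    have hpos : 0 < ‖T.adjoint y‖ := norm_pos_iff.2 h0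
    have h := (g y).le_of_opNorm_le (hC y) ⟨y, hy⟩
    rw [hg, ← inner_self_re_eq_norm, inner_self_eq_norm_mul_norm, Submodule.coe_norm, ← mul_assoc] at h
    have h := le_of_mul_le_mul_right h (norm_pos_iff.2 hy0)
    rw [inv_mul_le_iff₀ hpos, mul_comm] at h
    exact h.trans (by gcongr; exact le_max_left _ _)

/-- **Hörmander's functional-analytic lemma (necessity direction).**
Let `H₁`, `H₂` be complex Hilbert spaces, `T` a closed, densely defined linear
operator from `H₁` to `H₂`, and `F` a closed subspace of `H₂` containing the
range of `T`.  If `T` is surjective onto `F`, then there is a constant `c > 0`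
such that `c‖y‖² ≤ ‖T*y‖²` for all `y ∈ Dom(T*) ∩ F`. -/
theorem stmt1
    {H₁ H₂ : Type*}
    [NormedAddCommGroup H₁] [InnerProductSpace ℂ H₁] [CompleteSpace H₁]
    [NormedAddCommGroup H₂] [InnerProductSpace ℂ H₂] [CompleteSpace H₂]
    (T : H₁ →ₗ.[ℂ] H₂)
    (hTclosed : T.IsClosed)
    (hTdense : Dense (T.domain : Set H₁))
    (F : Submodule ℂ H₂) (hF : IsClosed (F : Set H₂))
    (hrange : ∀ x : T.domain, T x ∈ F)
    (hsurj : ∀ y ∈ F, ∃ x : T.domain, T x = y) :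
    ∃ c : ℝ, 0 < c ∧ ∀ y : T.adjoint.domain, (y : H₂) ∈ F →
      c * ‖(y : H₂)‖ ^ 2 ≤ ‖T.adjoint y‖ ^ 2 := by
  obtain ⟨C, hC, h⟩ := LinearPMap.exists_norm_le_mul_norm_adjoint hTdense hF hsurj
  refine ⟨(C ^ 2)⁻¹, by positivity, fun y hy ↦ ?_⟩
  rw [inv_mul_le_iff₀ (by positivity), ← mul_pow]
  exact pow_le_pow_left₀ (norm_nonneg _) (h y hy) 2
end
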